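/- Let G be a graph containing no jewel or pyramid, and let C be a clean shortest odd hole in G. Let u, v ∈ V(C) be distinct and nonadjacent, and let L1, L2 be the two subpaths of C joining u and v, where |E(L1)| < |E(L2)|. Then L1 is a shortest path in G between u and v. -/

import Mathlib

/-!
Common definitions: holes, odd holes, C-major vertices, induced paths,
pyramids, jewels, candidates, x-gaps, gaps and normal sets.
A hole of length `n` is encoded as an injective map `f : ZMod n → V`
such that adjacency in `G` between vertices of the hole holds exactly
for consecutive indices (i.e. the hole is an induced cycle).
-/

variable {V : Type*}

/-- A hole: an induced cycle of length `n ≥ 4`. -/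
def IsHole (G : SimpleGraph V) (n : ℕ) (f : ZMod n → V) : Prop :=
  4 ≤ n ∧ Function.Injective f ∧
    ∀ i j : ZMod n, G.Adj (f i) (f j) ↔ (j = i + 1 ∨ i = j + 1)

/-- An odd hole. -/
def IsOddHole (G : SimpleGraph V) (n : ℕ) (f : ZMod n → V) : Prop :=
  IsHole G n f ∧ Odd n

/-- A shortest odd hole: an odd hole of minimum length among all odd holes. -/
def IsShortestOddHole (G : SimpleGraph V) (n : ℕ) (f : ZMod n → V) : Prop :=
  IsOddHole G n f ∧ ∀ (m : ℕ) (g : ZMod m → V), IsOddHole G m g → n ≤ m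

/-- `G` has an odd hole. -/
def HasOddHole (G : SimpleGraph V) : Prop :=
  ∃ (n : ℕ) (f : ZMod n → V), IsOddHole G n f

/-- A vertex `v` is `C`-major (for the hole given by `f`): `v` is not on the hole and
no three consecutive vertices of the hole contain all neighbours of `v` on the hole. -/
def IsCMajor (G : SimpleGraph V) {n : ℕ} (f : ZMod n → V) (v : V) : Prop :=
  v ∉ Set.range f ∧
    ∀ i : ZMod n, ∃ j : ZMod n, G.Adj v (f j) ∧ j ≠ i - 1 ∧ j ≠ i ∧ j ≠ i + 1

/-- An induced path of length `k`, encoded by its sequence of vertices: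
adjacency holds exactly between consecutive vertices. -/
def IsInducedPathMap (G : SimpleGraph V) (k : ℕ) (p : Fin (k + 1) → V) : Prop :=
  Function.Injective p ∧
    ∀ i j : Fin (k + 1), G.Adj (p i) (p j) ↔ (i.val + 1 = j.val ∨ j.val + 1 = i.val)

/-- A (not necessarily induced) path of length `k`, encoded by its sequence of vertices. -/
def IsPathMap (G : SimpleGraph V) (k : ℕ) (p : Fin (k + 1) → V) : Prop :=
  Function.Injective p ∧ ∀ i : Fin k, G.Adj (p i.castSucc) (p i.succ)

/-- A pyramid with apex `v0`, base `{v1, v2, v3}`, and paths `p1, p2, p3`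
(of lengths `k1, k2, k3`) from `v0` to `v1, v2, v3` respectively. -/
def IsPyramid (G : SimpleGraph V) (v0 v1 v2 v3 : V) (k1 k2 k3 : ℕ)
    (p1 : Fin (k1 + 1) → V) (p2 : Fin (k2 + 1) → V) (p3 : Fin (k3 + 1) → V) : Prop :=
  IsInducedPathMap G k1 p1 ∧ IsInducedPathMap G k2 p2 ∧ IsInducedPathMap G k3 p3 ∧
  p1 0 = v0 ∧ p2 0 = v0 ∧ p3 0 = v0 ∧
  p1 (Fin.last k1) = v1 ∧ p2 (Fin.last k2) = v2 ∧ p3 (Fin.last k3) = v3 ∧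
  v1 ≠ v0 ∧ v2 ≠ v0 ∧ v3 ≠ v0 ∧
  G.Adj v1 v2 ∧ G.Adj v1 v3 ∧ G.Adj v2 v3 ∧
  ((2 ≤ k1 ∧ 2 ≤ k2) ∨ (2 ≤ k1 ∧ 2 ≤ k3) ∨ (2 ≤ k2 ∧ 2 ≤ k3)) ∧
  (Set.range p1 ∩ Set.range p2 ⊆ {v0}) ∧
  (Set.range p1 ∩ Set.range p3 ⊆ {v0}) ∧
  (Set.range p2 ∩ Set.range p3 ⊆ {v0}) ∧
  (∀ u w : V, u ∈ Set.range p1 → w ∈ Set.range p2 → u ≠ v0 → w ≠ v0 →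
    G.Adj u w → u = v1 ∧ w = v2) ∧
  (∀ u w : V, u ∈ Set.range p1 → w ∈ Set.range p3 → u ≠ v0 → w ≠ v0 →
    G.Adj u w → u = v1 ∧ w = v3) ∧
  (∀ u w : V, u ∈ Set.range p2 → w ∈ Set.range p3 → u ≠ v0 → w ≠ v0 →
    G.Adj u w → u = v2 ∧ w = v3)

/-- `G` contains a pyramid. -/
def ContainsPyramid (G : SimpleGraph V) : Prop :=
  ∃ (v0 v1 v2 v3 : V) (k1 k2 k3 : ℕ) (p1 : Fin (k1 + 1) → V)
    (p2 : Fin (k2 + 1) → V) (p3 : Fin (k3 + 1) → V),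
    IsPyramid G v0 v1 v2 v3 k1 k2 k3 p1 p2 p3

/-- A jewel on vertices `v1, …, v5` together with the path `p` (of length `k`)
from `v1` to `v4`. -/
def IsJewel (G : SimpleGraph V) (v1 v2 v3 v4 v5 : V) (k : ℕ)
    (p : Fin (k + 1) → V) : Prop :=
  List.Pairwise Ne [v1, v2, v3, v4, v5] ∧
  G.Adj v1 v2 ∧ G.Adj v2 v3 ∧ G.Adj v3 v4 ∧ G.Adj v4 v5 ∧ G.Adj v5 v1 ∧
  ¬ G.Adj v1 v3 ∧ ¬ G.Adj v2 v4 ∧ ¬ G.Adj v1 v4 ∧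
  IsInducedPathMap G k p ∧ p 0 = v1 ∧ p (Fin.last k) = v4 ∧
  ∀ i : Fin (k + 1), i ≠ 0 → i ≠ Fin.last k →
    ¬ G.Adj v2 (p i) ∧ ¬ G.Adj v3 (p i) ∧ ¬ G.Adj v5 (p i)

/-- `G` contains a jewel. -/
def ContainsJewel (G : SimpleGraph V) : Prop :=
  ∃ (v1 v2 v3 v4 v5 : V) (k : ℕ) (p : Fin (k + 1) → V),
    IsJewel G v1 v2 v3 v4 v5 k p

/-- A candidate: a graph with no jewel, no pyramid, and no heavy-cleanable shortest
odd hole (a shortest odd hole is heavy-cleanable if some edge of it has the property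
that every major vertex is adjacent to one of its ends). -/
def Candidate (G : SimpleGraph V) : Prop :=
  ¬ ContainsJewel G ∧ ¬ ContainsPyramid G ∧
  ¬ ∃ (n : ℕ) (f : ZMod n → V) (i : ZMod n), IsShortestOddHole G n f ∧
      ∀ v : V, IsCMajor G f v → (G.Adj v (f i) ∨ G.Adj v (f (i + 1)))

/-- An `x`-gap of a hole `f : ZMod n → V`: an induced path of the hole, of length
`ℓ ≥ 2`, starting at index `a` and ending at index `a + ℓ`, whose ends are adjacent
to `x` and whose internal vertices are nonadjacent to `x`. (The condition `ℓ + 2 ≤ n`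
says that the arc is an induced path of the hole.) -/
def IsXGap (G : SimpleGraph V) {n : ℕ} (f : ZMod n → V) (x : V) (a : ZMod n)
    (ℓ : ℕ) : Prop :=
  2 ≤ ℓ ∧ ℓ + 2 ≤ n ∧ G.Adj x (f a) ∧ G.Adj x (f (a + (ℓ : ZMod n))) ∧
    ∀ t : ℕ, 0 < t → t < ℓ → ¬ G.Adj x (f (a + (t : ZMod n)))

/-- `ℓ` is the length of an `A`-gap of the cycle on `ZMod n` (with `A ⊆ ZMod n`):
either `A = ∅` and the gap is the whole cycle, or the gap runs from some `i ∈ A`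
to `i + ℓ ∈ A` with no internal vertex in `A`. -/
def IsGapLength (n : ℕ) (A : Set (ZMod n)) (ℓ : ℕ) : Prop :=
  (A = ∅ ∧ ℓ = n) ∨
  (2 ≤ ℓ ∧ ℓ ≤ n ∧ ∃ i ∈ A, (i + (ℓ : ZMod n)) ∈ A ∧
    ∀ t : ℕ, 0 < t → t < ℓ → (i + (t : ZMod n)) ∉ A)

/-- `A` is normal in the cycle on `ZMod n`: every `A`-gap has even length. -/
def NormalInCycle (n : ℕ) (A : Set (ZMod n)) : Prop :=
  ∀ ℓ : ℕ, IsGapLength n A ℓ → Even ℓ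

/-- There is a walk of length at most `m` from `x` to `y`. -/
def WalkWithin (G : SimpleGraph V) (m : ℤ) (x y : V) : Prop :=
  ∃ w : G.Walk x y, (w.length : ℤ) ≤ m

/-- `D` runs periodically around an induced cycle of length `m`. -/
def InducedCycle (G : SimpleGraph V) (m : ℤ) (D : ℤ → V) : Prop :=
  (∀ x, D (x + m) = D x) ∧
    ∀ x y, x < y → y < x + m → D x ≠ D y ∧ (G.Adj (D x) (D y) ↔ y = x + 1 ∨ y = x + m - 1)

/-- The vertices `Q s, …, Q e` form an induced path. -/
def InducedPathOn (G : SimpleGraph V) (s e : ℤ) (Q : ℤ → V) : Prop :=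
  ∀ i j, s ≤ i → i < j → j ≤ e → Q i ≠ Q j ∧ (G.Adj (Q i) (Q j) ↔ j = i + 1)

section Basics

variable {G : SimpleGraph V}

namespace WalkWithin

theorem refl (x : V) : WalkWithin G 0 x x := ⟨.nil, by simp⟩

theorem of_adj {x y : V} (h : G.Adj x y) : WalkWithin G 1 x y := ⟨h.toWalk, by simp⟩

theorem symm {m : ℤ} {x y : V} (h : WalkWithin G m x y) : WalkWithin G m y x := by
  obtain ⟨w, hw⟩ := h
  exact ⟨w.reverse, by simpa using hw⟩

theorem trans {m l : ℤ} {x y z : V} (h : WalkWithin G m x y) (h' : WalkWithin G l y z) :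
    WalkWithin G (m + l) x z := by
  obtain ⟨w, hw⟩ := h
  obtain ⟨w', hw'⟩ := h'
  exact ⟨w.append w', by rw [SimpleGraph.Walk.length_append]; push_cast; omega⟩

theorem mono {m l : ℤ} {x y : V} (h : WalkWithin G m x y) (hl : m ≤ l) : WalkWithin G l x y := by
  obtain ⟨w, hw⟩ := h
  exact ⟨w, hw.trans hl⟩

theorem along {p : ℤ → V} {s e : ℤ} (hp : ∀ i, s ≤ i → i < e → G.Adj (p i) (p (i + 1)))
    {i j : ℤ} (hi : s ≤ i) (hij : i ≤ j) (hj : j ≤ e) : WalkWithin G (j - i) (p i) (p j) := by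
  induction j, hij using Int.leInduction with
  | base => simpa using refl (p i)
  | succ j hij ih =>
    have := (ih (by omega)).trans (of_adj (hp j (by omega) (by omega)))
    exact this.mono (by omega)

end WalkWithin

namespace InducedCycle

variable {m : ℤ} {D : ℤ → V}

theorem shift (h : InducedCycle G m D) (s : ℤ) : InducedCycle G m (fun x => D (s + x)) := by
  refine ⟨fun x => ?_, fun x y hxy hy => ?_⟩
  · simpa [add_assoc] using h.1 (s + x)
  · have := h.2 (s + x) (s + y) (by omega) (by omega)
    refine ⟨this.1, this.2.trans ?_⟩
    omega

theorem reflect (h : InducedCycle G m D) (s : ℤ) : InducedCycle G m (fun x => D (s - x)) := by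
  refine ⟨fun x => ?_, fun x y hxy hy => ?_⟩
  · have := h.1 (s - (x + m))
    simp only at this ⊢
    rw [← this]
    congr 1
    omega
  · have := h.2 (s - y) (s - x) (by omega) (by omega)
    refine ⟨this.1.symm, (G.adj_comm _ _).trans (this.2.trans ?_)⟩
    omega

theorem sub_period (h : InducedCycle G m D) (x : ℤ) : D (x - m) = D x := by
  simpa using (h.1 (x - m)).symm

theorem add_mul_period (h : InducedCycle G m D) (x t : ℤ) : D (x + t * m) = D x := by
  induction t using Int.induction_on with
  | zero => simp
  | succ t ih => rw [← ih, ← h.1 (x + t * m)]; congr 1; ring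
  | pred t ih => rw [← ih, ← h.1 (x + (-t - 1) * m)]; congr 1; ring

theorem exists_window (h : InducedCycle G m D) (hm : 0 < m) (x : ℤ) :
    ∃ y, 0 ≤ y ∧ y < m ∧ D x = D y := by
  refine ⟨x % m, Int.emod_nonneg _ hm.ne', Int.emod_lt_of_pos _ hm, ?_⟩
  rw [← h.add_mul_period (x % m) (x / m)]
  congr 1
  rw [mul_comm]
  exact (Int.emod_add_mul_ediv x m).symm

theorem adj_succ (h : InducedCycle G m D) (hm : 4 ≤ m) (x : ℤ) : G.Adj (D x) (D (x + 1)) :=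
  (h.2 x (x + 1) (by omega) (by omega)).2.2 (Or.inl rfl)

theorem path (h : InducedCycle G m D) {s e : ℤ} (he : e < s + m - 1) : InducedPathOn G s e D := by
  intro i j hi hij hj
  refine ⟨(h.2 i j hij (by omega)).1, (h.2 i j hij (by omega)).2.trans ?_⟩
  omega

/-- A sequence of `m` vertices closing up to an induced cycle extends periodically. -/
theorem exists_extend (s : ℤ) (g : ℤ → V)
    (hg : ∀ x y, s ≤ x → x < y → y < s + m →
      g x ≠ g y ∧ (G.Adj (g x) (g y) ↔ y = x + 1 ∨ (x = s ∧ y = s + m - 1))) :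
    ∃ D, InducedCycle G m D ∧ ∀ x, s ≤ x → x < s + m → D x = g x := by
  refine ⟨fun x => g (s + (x - s) % m), ⟨fun x => ?_, fun x y hxy hy => ?_⟩, fun x hx hx' => ?_⟩
  · have : (x + m - s) % m = (x - s) % m := by
      rw [show x + m - s = x - s + m by ring, Int.add_emod_right]
    simp only [this]
  · have hm : 0 < m := by omega
    have hr := Int.emod_nonneg (x - s) hm.ne'
    have hr' := Int.emod_nonneg (y - s) hm.ne'
    have hl := Int.emod_lt_of_pos (x - s) hm
    have hl' := Int.emod_lt_of_pos (y - s) hm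
    have e := Int.emod_add_mul_ediv (x - s) m
    have e' := Int.emod_add_mul_ediv (y - s) m
    beta_reduce
    generalize (x - s) % m = r at *
    generalize (y - s) % m = r' at *
    generalize (x - s) / m = q at *
    generalize (y - s) / m = q' at *
    have hq : q' = q ∨ q' = q + 1 := by
      have h1 : q ≤ q' := by
        by_contra hlt
        have : m * (q' + 1) ≤ m * q := mul_le_mul_of_nonneg_left (by omega) hm.le
        have : m * (q' + 1) = m * q' + m := by ring
        omega
      have h2 : q' ≤ q + 1 := by
        by_contra hlt
        have : m * (q + 2) ≤ m * q' := mul_le_mul_of_nonneg_left (by omega) hm.le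
        have : m * (q + 2) = m * q + 2 * m := by ring
        omega
      omega
    rcases hq with rfl | rfl
    · obtain ⟨h1, h2⟩ := hg (s + r) (s + r') (by omega) (by omega) (by omega)
      refine ⟨h1, h2.trans ?_⟩
      omega
    · have : m * (q + 1) = m * q + m := by ring
      obtain ⟨h1, h2⟩ := hg (s + r') (s + r) (by omega) (by omega) (by omega)
      refine ⟨h1.symm, (G.adj_comm _ _).trans (h2.trans ?_)⟩
      omega
  · simp only
    rw [Int.emod_eq_of_lt (by omega) (by omega)]
    congr 1
    omega

/-- Two disjoint induced paths joined end to end form an induced cycle. -/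
theorem of_paths {X Y : ℤ → V} {s t u v : ℤ} (hst : s ≤ t) (huv : u ≤ v)
    (hX : InducedPathOn G s t X) (hY : InducedPathOn G u v Y)
    (hXY : ∀ i j, s ≤ i → i ≤ t → u ≤ j → j ≤ v →
      X i ≠ Y j ∧ (G.Adj (X i) (Y j) ↔ (i = t ∧ j = u) ∨ (i = s ∧ j = v))) :
    ∃ D, InducedCycle G (t - s + 1 + (v - u + 1)) D ∧ (∀ x, s ≤ x → x ≤ t → D x = X x) ∧
      ∀ y, u ≤ y → y ≤ v → D (y - u + t + 1) = Y y := by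
  obtain ⟨D, hD, hDg⟩ := exists_extend (G := G) (m := t - s + 1 + (v - u + 1)) s
    (fun x => if x ≤ t then X x else Y (x - t - 1 + u)) (by
      intro x y hx hxy hy
      by_cases h1 : x ≤ t
      · by_cases h2 : y ≤ t
        · simp only [h1, h2, if_true]
          obtain ⟨h3, h4⟩ := hX x y hx hxy h2
          refine ⟨h3, h4.trans ?_⟩
          omega
        · simp only [h1, h2, if_true, if_false]
          obtain ⟨h3, h4⟩ := hXY x (y - t - 1 + u) hx h1 (by omega) (by omega)
          refine ⟨h3, h4.trans ?_⟩
          omega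
      · have h2 : ¬ y ≤ t := by omega
        simp only [h1, h2, if_false]
        obtain ⟨h3, h4⟩ := hY (x - t - 1 + u) (y - t - 1 + u) (by omega) (by omega) (by omega)
        refine ⟨h3, h4.trans ?_⟩
        omega)
  refine ⟨D, hD, fun x hx hx' => ?_, fun y hy hy' => ?_⟩
  · rw [hDg x hx (by omega)]
    simp [hx']
  · rw [hDg _ (by omega) (by omega), if_neg (by omega)]
    congr 1
    omega

end InducedCycle

theorem InducedPathOn.reflect {s e : ℤ} {Q : ℤ → V} (h : InducedPathOn G s e Q) (t : ℤ) :
    InducedPathOn G (t - e) (t - s) (fun x => Q (t - x)) := by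
  intro i j hi hij hj
  obtain ⟨h1, h2⟩ := h (t - j) (t - i) (by omega) (by omega) (by omega)
  refine ⟨h1.symm, (G.adj_comm _ _).trans (h2.trans ?_)⟩
  omega

theorem InducedPathOn.mono {s e s' e' : ℤ} {Q : ℤ → V} (h : InducedPathOn G s e Q)
    (hs : s ≤ s') (he : e' ≤ e) : InducedPathOn G s' e' Q :=
  fun i j hi hij hj => h i j (by omega) hij (by omega)

theorem InducedPathOn.shift {s e : ℤ} {Q : ℤ → V} (h : InducedPathOn G s e Q) (t : ℤ) :
    InducedPathOn G (s - t) (e - t) (fun x => Q (t + x)) := by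
  intro i j hi hij hj
  obtain ⟨h1, h2⟩ := h (t + i) (t + j) (by omega) (by omega) (by omega)
  exact ⟨h1, h2.trans (by omega)⟩

/-- Prepending a vertex to an induced path. -/
theorem InducedPathOn.cons {e : ℤ} {Q : ℤ → V} {v : V} (h : InducedPathOn G 1 e Q)
    (hv : ∀ i, 1 ≤ i → i ≤ e → v ≠ Q i ∧ (G.Adj v (Q i) ↔ i = 1)) :
    InducedPathOn G 0 e (fun x => if x ≤ 0 then v else Q x) := by
  intro i j hi hij hj
  have hj0 : ¬ j ≤ 0 := by omega
  by_cases hi0 : i ≤ 0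
  · simp only [hi0, hj0, if_true, if_false]
    obtain ⟨h1, h2⟩ := hv j (by omega) hj
    exact ⟨h1, h2.trans (by omega)⟩
  · simp only [hi0, hj0, if_false]
    exact h i j (by omega) hij hj

theorem InducedPathOn.isInducedPathMap {k : ℕ} {Q : ℤ → V} (h : InducedPathOn G 0 k Q) :
    IsInducedPathMap G k (fun i => Q (i.val : ℤ)) := by
  constructor
  · intro i j hij
    by_contra hne
    rcases lt_or_gt_of_ne (fun h' => hne (Fin.ext h')) with hlt | hlt
    · exact (h i.val j.val (by omega) (by omega) (by omega)).1 hij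
    · exact (h j.val i.val (by omega) (by omega) (by omega)).1 hij.symm
  · intro i j
    rcases lt_trichotomy i.val j.val with hlt | heq | hlt
    · rw [(h i.val j.val (by omega) (by omega) (by omega)).2]
      omega
    · simp [heq]
    · rw [G.adj_comm, (h j.val i.val (by omega) (by omega) (by omega)).2]
      omega

/-- Three induced paths from a common vertex to the vertices of a triangle form a pyramid. -/
theorem containsPyramid_of_paths {k₁ k₂ k₃ : ℤ} {Q₁ Q₂ Q₃ : ℤ → V}
    (p₁ : 1 ≤ k₁) (p₂ : 1 ≤ k₂) (p₃ : 1 ≤ k₃)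
    (hk : (2 ≤ k₁ ∧ 2 ≤ k₂) ∨ (2 ≤ k₁ ∧ 2 ≤ k₃) ∨ (2 ≤ k₂ ∧ 2 ≤ k₃))
    (h₁ : InducedPathOn G 0 k₁ Q₁) (h₂ : InducedPathOn G 0 k₂ Q₂) (h₃ : InducedPathOn G 0 k₃ Q₃)
    (e₂ : Q₂ 0 = Q₁ 0) (e₃ : Q₃ 0 = Q₁ 0)
    (h₁₂ : ∀ i j, 1 ≤ i → i ≤ k₁ → 1 ≤ j → j ≤ k₂ →
      Q₁ i ≠ Q₂ j ∧ (G.Adj (Q₁ i) (Q₂ j) ↔ i = k₁ ∧ j = k₂))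
    (h₁₃ : ∀ i j, 1 ≤ i → i ≤ k₁ → 1 ≤ j → j ≤ k₃ →
      Q₁ i ≠ Q₃ j ∧ (G.Adj (Q₁ i) (Q₃ j) ↔ i = k₁ ∧ j = k₃))
    (h₂₃ : ∀ i j, 1 ≤ i → i ≤ k₂ → 1 ≤ j → j ≤ k₃ →
      Q₂ i ≠ Q₃ j ∧ (G.Adj (Q₂ i) (Q₃ j) ↔ i = k₂ ∧ j = k₃)) :
    ContainsPyramid G := by
  lift k₁ to ℕ using by omega
  lift k₂ to ℕ using by omega
  lift k₃ to ℕ using by omega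
  have disjoint : ∀ {a b : ℕ} {Q R : ℤ → V}, Q 0 = Q₁ 0 →
      (∀ i j : ℤ, 1 ≤ i → i ≤ a → 1 ≤ j → j ≤ b →
        Q i ≠ R j ∧ (G.Adj (Q i) (R j) ↔ i = a ∧ j = b)) → R 0 = Q₁ 0 →
      (Set.range fun i : Fin (a + 1) => Q (i.val : ℤ)) ∩
        (Set.range fun i : Fin (b + 1) => R (i.val : ℤ)) ⊆ {Q₁ 0} := by
    rintro a b Q R hQ h hR x ⟨⟨i, rfl⟩, ⟨j, hj⟩⟩
    simp only at hj ⊢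
    by_cases hi : i.val = 0
    · simp [hi, hQ]
    by_cases hj0 : j.val = 0
    · rw [← hj, hj0]
      simp [hR]
    · exact ((h i.val j.val (by omega) (by omega) (by omega) (by omega)).1 hj.symm).elim
  have cross : ∀ {a b : ℕ} {Q R : ℤ → V}, Q 0 = Q₁ 0 →
      (∀ i j : ℤ, 1 ≤ i → i ≤ a → 1 ≤ j → j ≤ b →
        Q i ≠ R j ∧ (G.Adj (Q i) (R j) ↔ i = a ∧ j = b)) → R 0 = Q₁ 0 →
      ∀ u w : V, u ∈ (Set.range fun i : Fin (a + 1) => Q (i.val : ℤ)) →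
        w ∈ (Set.range fun i : Fin (b + 1) => R (i.val : ℤ)) → u ≠ Q₁ 0 → w ≠ Q₁ 0 →
        G.Adj u w → u = Q a ∧ w = R b := by
    rintro a b Q R hQ h hR _ _ ⟨i, rfl⟩ ⟨j, rfl⟩ hi hj hadj
    simp only at hi hj hadj ⊢
    have hi0 : i.val ≠ 0 := fun h0 => hi (by simp [h0, hQ])
    have hj0 : j.val ≠ 0 := fun h0 => hj (by simp [h0, hR])
    obtain ⟨h1, h2⟩ :=
      (h i.val j.val (by omega) (by omega) (by omega) (by omega)).2.1 hadj
    rw [h1, h2]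
    exact ⟨rfl, rfl⟩
  refine ⟨Q₁ 0, Q₁ k₁, Q₂ k₂, Q₃ k₃, k₁, k₂, k₃, fun i => Q₁ (i.val : ℤ), fun i => Q₂ (i.val : ℤ),
    fun i => Q₃ (i.val : ℤ), h₁.isInducedPathMap, h₂.isInducedPathMap, h₃.isInducedPathMap,
    by simp, by simpa using e₂, by simpa using e₃, by simp, by simp, by simp,
    (h₁ 0 k₁ le_rfl (by omega) le_rfl).1.symm, ?_, ?_,
    (h₁₂ k₁ k₂ (by omega) le_rfl (by omega) le_rfl).2.2 ⟨rfl, rfl⟩,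
    (h₁₃ k₁ k₃ (by omega) le_rfl (by omega) le_rfl).2.2 ⟨rfl, rfl⟩,
    (h₂₃ k₂ k₃ (by omega) le_rfl (by omega) le_rfl).2.2 ⟨rfl, rfl⟩, by omega,
    disjoint rfl h₁₂ e₂, disjoint rfl h₁₃ e₃, disjoint e₂ h₂₃ e₃,
    cross rfl h₁₂ e₂, cross rfl h₁₃ e₃, cross e₂ h₂₃ e₃⟩
  · rw [← e₂]
    exact (h₂ 0 k₂ le_rfl (by omega) le_rfl).1.symm
  · rw [← e₃]
    exact (h₃ 0 k₃ le_rfl (by omega) le_rfl).1.symm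

/-- An induced path `q 0, …, q r` disjoint from an induced cycle, whose first vertex attaches
exactly to an edge of the cycle, whose last vertex attaches to exactly one vertex of the cycle,
and whose inner vertices do not attach to the cycle, gives a pyramid. -/
theorem InducedCycle.containsPyramid_of_single {m r y : ℤ} {D q : ℤ → V}
    (hD : InducedCycle G m D) (hm : 4 ≤ m) (hr : 1 ≤ r) (hq : InducedPathOn G 0 r q)
    (hdisj : ∀ t x, 0 ≤ t → t ≤ r → q t ≠ D x)
    (h0 : G.Adj (q 0) (D 0)) (h1 : G.Adj (q 0) (D 1))
    (h2 : ∀ x, 1 < x → x < m → ¬ G.Adj (q 0) (D x))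
    (hmid : ∀ t x, 0 < t → t < r → ¬ G.Adj (q t) (D x))
    (hy : 2 ≤ y) (hym : y < m) (hry : G.Adj (q r) (D y))
    (hrn : ∀ x, y < x → x < y + m → ¬ G.Adj (q r) (D x)) : ContainsPyramid G := by
  have hqD : ∀ t x, 1 ≤ x → x ≤ m → 0 ≤ t → t ≤ r → x ≠ y →
      (G.Adj (q t) (D x) ↔ t = 0 ∧ (x = 1 ∨ x = m)) := by
    intro t x hx hxm ht htr hxy
    rcases eq_or_lt_of_le ht with rfl | ht0
    · by_cases hx1 : x = 1
      · subst hx1; simp [h1]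
      by_cases hxm' : x = m
      · subst hxm'
        have := hD.1 0
        rw [zero_add] at this
        simp [this, h0]
      · simp [hx1, hxm', h2 x (by omega) (by omega)]
    · have hna : ¬ G.Adj (q t) (D x) := by
        rcases eq_or_lt_of_le htr with rfl | htr'
        · by_cases hlt : y < x
          · exact hrn x hlt (by omega)
          · rw [← hD.1 x]
            exact hrn (x + m) (by omega) (by omega)
        · exact hmid t x ht0 htr'
      simp [hna, ht0.ne']
  have hQ₃ : InducedPathOn G 0 (r + 1) (fun x => if x ≤ 0 then D y else q (r + 1 - x)) := by
    refine InducedPathOn.cons ((hq.reflect (r + 1)).mono (by omega) (by omega)) fun i hi hir => ?_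
    refine ⟨(hdisj (r + 1 - i) y (by omega) (by omega)).symm, ?_⟩
    by_cases hi1 : i = 1
    · subst hi1
      simpa using hry.symm
    · simp only [hi1, iff_false]
      rw [G.adj_comm]
      by_cases hir' : i = r + 1
      · subst hir'
        simpa using h2 y (by omega) hym
      · exact hmid _ _ (by omega) (by omega)
  refine containsPyramid_of_paths (k₁ := y - 1) (k₂ := m - y) (k₃ := r + 1)
    (Q₁ := fun x => D (y - x)) (Q₂ := fun x => D (y + x))
    (Q₃ := fun x => if x ≤ 0 then D y else q (r + 1 - x)) (by omega) (by omega) (by omega)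
    (by omega) ((hD.reflect y).path (by omega)) ((hD.shift y).path (by omega)) hQ₃
    (by simp) (by simp) ?_ ?_ ?_
  · intro i j hi hi' hj hj'
    obtain ⟨h3, h4⟩ := hD.2 (y - i) (y + j) (by omega) (by omega)
    exact ⟨h3, h4.trans (by omega)⟩
  · intro i j hi hi' hj hj'
    simp only [show ¬ j ≤ 0 by omega, if_false]
    refine ⟨(hdisj _ _ (by omega) (by omega)).symm, ?_⟩
    rw [G.adj_comm, hqD _ _ (by omega) (by omega) (by omega) (by omega) (by omega)]
    omega
  · intro i j hi hi' hj hj'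
    simp only [show ¬ j ≤ 0 by omega, if_false]
    refine ⟨(hdisj _ _ (by omega) (by omega)).symm, ?_⟩
    rw [G.adj_comm, hqD _ _ (by omega) (by omega) (by omega) (by omega) (by omega)]
    omega

/-- The analogue of `InducedCycle.containsPyramid_of_single` in which the last vertex of the path
attaches to two vertices at distance two on the cycle, and possibly to the vertex between. -/
theorem InducedCycle.containsPyramid_of_double {m r y : ℤ} {D q : ℤ → V}
    (hD : InducedCycle G m D) (hr : 1 ≤ r) (hq : InducedPathOn G 0 r q)
    (hdisj : ∀ t x, 0 ≤ t → t ≤ r → q t ≠ D x)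
    (h0 : G.Adj (q 0) (D 0)) (h1 : G.Adj (q 0) (D 1))
    (h2 : ∀ x, 1 < x → x < m → ¬ G.Adj (q 0) (D x))
    (hmid : ∀ t x, 0 < t → t < r → ¬ G.Adj (q t) (D x))
    (hy : 3 ≤ y) (hym : y ≤ m - 2) (hry : G.Adj (q r) (D (y - 1))) (hry' : G.Adj (q r) (D (y + 1)))
    (hrn : ∀ x, y + 1 < x → x < y - 1 + m → ¬ G.Adj (q r) (D x)) : ContainsPyramid G := by
  have hqD : ∀ t x, 1 ≤ x → x ≤ m → 0 ≤ t → t < r →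
      (G.Adj (q t) (D x) ↔ t = 0 ∧ (x = 1 ∨ x = m)) := by
    intro t x hx hxm ht htr
    rcases eq_or_lt_of_le ht with rfl | ht0
    · by_cases hx1 : x = 1
      · subst hx1; simp [h1]
      by_cases hxm' : x = m
      · subst hxm'
        have := hD.1 0
        rw [zero_add] at this
        simp [this, h0]
      · simp [hx1, hxm', h2 x (by omega) (by omega)]
    · simp [hmid t x ht0 htr, ht0.ne']
  have hQ₁ : InducedPathOn G 0 (y - 1) (fun x => if x ≤ 0 then q r else D (y - x)) := by
    refine InducedPathOn.cons ((hD.reflect y).path (by omega)) fun i hi hir => ?_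
    refine ⟨hdisj _ _ (by omega) (by omega), ?_⟩
    by_cases hi1 : i = 1
    · subst hi1
      simpa using hry
    · simp only [hi1, iff_false]
      rw [← hD.1 (y - i)]
      exact hrn _ (by omega) (by omega)
  have hQ₂ : InducedPathOn G 0 (m - y) (fun x => if x ≤ 0 then q r else D (y + x)) := by
    refine InducedPathOn.cons ((hD.shift y).path (by omega)) fun i hi hir => ?_
    refine ⟨hdisj _ _ (by omega) (by omega), ?_⟩
    by_cases hi1 : i = 1
    · subst hi1
      simpa using hry'
    · simp only [hi1, iff_false]
      exact hrn _ (by omega) (by omega)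
  refine containsPyramid_of_paths (k₁ := y - 1) (k₂ := m - y) (k₃ := r)
    (Q₁ := fun x => if x ≤ 0 then q r else D (y - x))
    (Q₂ := fun x => if x ≤ 0 then q r else D (y + x))
    (Q₃ := fun x => q (r - x)) (by omega) (by omega) (by omega)
    (by omega) hQ₁ hQ₂ ((hq.reflect r).mono (by omega) (by omega))
    (by simp) (by simp) ?_ ?_ ?_
  · intro i j hi hi' hj hj'
    simp only [show ¬ j ≤ 0 by omega, show ¬ i ≤ 0 by omega, if_false]
    obtain ⟨h3, h4⟩ := hD.2 (y - i) (y + j) (by omega) (by omega)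
    exact ⟨h3, h4.trans (by omega)⟩
  · intro i j hi hi' hj hj'
    simp only [show ¬ i ≤ 0 by omega, if_false]
    refine ⟨(hdisj _ _ (by omega) (by omega)).symm, ?_⟩
    rw [G.adj_comm, hqD _ _ (by omega) (by omega) (by omega) (by omega)]
    omega
  · intro i j hi hi' hj hj'
    simp only [show ¬ i ≤ 0 by omega, if_false]
    refine ⟨(hdisj _ _ (by omega) (by omega)).symm, ?_⟩
    rw [G.adj_comm, hqD _ _ (by omega) (by omega) (by omega) (by omega)]
    omega

end Basics

/-- A clean shortest odd hole `c` of length `n` in a graph with no jewel or pyramid, together with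
a walk `p 0, …, p k` from `c 0` to `c d` that is shorter than both arcs of the hole between its
ends, where `k` is as small as possible over all such walks. -/
structure Shortcut (G : SimpleGraph V) (n k d : ℤ) (c p : ℤ → V) : Prop where
  cycle : InducedCycle G n c
  odd : Odd n
  even_of_lt : ∀ m D, InducedCycle G m D → 4 ≤ m → m < n → Even m
  clean : ∀ v, (∀ x, v ≠ c x) → ∃ s, ∀ x, s + 2 ≤ x → x ≤ s + n - 2 → ¬ G.Adj v (c x)
  no_pyramid : ¬ ContainsPyramid G
  no_jewel : ¬ ContainsJewel G
  nonneg : 0 ≤ k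
  lt : k < d
  two_mul_lt : 2 * d < n
  start_eq : p 0 = c 0
  end_eq : p k = c d
  adj : ∀ i, 0 ≤ i → i < k → G.Adj (p i) (p (i + 1))
  minimal : ∀ m x y, m < k → x ≤ y → y ≤ x + n → WalkWithin G m (c x) (c y) →
    y - x ≤ m ∨ x + n - y ≤ m

/-- On the cycle `c` of length `n`, the neighbours of `p 1` lie on the arc from `-α'` to `α`, whose
ends are neighbours of `p 1`. -/
structure StartArc (G : SimpleGraph V) (n : ℤ) (c p : ℤ → V) (α α' : ℤ) : Prop where
  nonneg : 0 ≤ α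
  nonneg' : 0 ≤ α'
  le : α + α' ≤ 2
  adj : G.Adj (p 1) (c α)
  adj' : G.Adj (p 1) (c (-α'))
  not_adj : ∀ x, α < x → x < n - α' → ¬ G.Adj (p 1) (c x)

namespace Shortcut

variable {G : SimpleGraph V} {n k d : ℤ} {c p : ℤ → V}

theorem reverse (h : Shortcut G n k d c p) :
    Shortcut G n k d (fun x => c (d - x)) (fun i => p (k - i)) where
  cycle := h.cycle.reflect d
  odd := h.odd
  even_of_lt := h.even_of_lt
  clean v hv := by
    obtain ⟨s, hs⟩ := h.clean v (fun x => by simpa using hv (d - x))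
    exact ⟨d - s - n, fun x hx hx' => hs _ (by omega) (by omega)⟩
  no_pyramid := h.no_pyramid
  no_jewel := h.no_jewel
  nonneg := h.nonneg
  lt := h.lt
  two_mul_lt := h.two_mul_lt
  start_eq := by simpa using h.end_eq
  end_eq := by simpa using h.start_eq
  adj i hi hik := by
    have := (h.adj (k - (i + 1)) (by omega) (by omega)).symm
    rwa [show k - (i + 1) + 1 = k - i by ring] at this
  minimal m x y hm hxy hy hw := by
    have := h.minimal m (d - y) (d - x) hm (by omega) (by omega) hw.symm
    omega

theorem walk (h : Shortcut G n k d c p) {i j : ℤ} (hi : 0 ≤ i) (hij : i ≤ j) (hj : j ≤ k) :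
    WalkWithin G (j - i) (p i) (p j) :=
  WalkWithin.along h.adj hi hij hj

theorem length_le (h : Shortcut G n k d c p) {m : ℤ} (hw : WalkWithin G m (c 0) (c d)) : k ≤ m := by
  have := h.lt
  have := h.two_mul_lt
  have := h.nonneg
  by_contra hlt
  have := h.minimal m 0 d (by omega) (by omega) (by omega) hw
  omega

theorem path (h : Shortcut G n k d c p) : InducedPathOn G 0 k p := by
  intro i j hi hij hj
  have w1 := h.walk le_rfl hi (by omega)
  have w2 := h.walk (show 0 ≤ j by omega) hj le_rfl
  rw [h.start_eq] at w1
  rw [h.end_eq] at w2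
  refine ⟨fun heq => ?_, fun hadj => ?_, ?_⟩
  · rw [heq] at w1
    have := h.length_le (w1.trans w2)
    omega
  · have := h.length_le ((w1.trans (.of_adj hadj)).trans w2)
    omega
  · rintro rfl
    exact h.adj i hi (by omega)

theorem dist_of_walk (h : Shortcut G n k d c p) {m x y : ℤ} (hm : m < k)
    (hw : WalkWithin G m (c x) (c y)) :
    (x ≤ y → y ≤ x + n → y - x ≤ m ∨ x + n - y ≤ m) ∧
      (y ≤ x → x ≤ y + n → x - y ≤ m ∨ y + n - x ≤ m) :=
  ⟨fun h1 h2 => h.minimal m x y hm h1 h2 hw, fun h1 h2 => h.minimal m y x hm h1 h2 hw.symm⟩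

theorem dist_of_adj_adj (h : Shortcut G n k d c p) {i j x y : ℤ} (hi : 0 ≤ i) (hij : i ≤ j)
    (hj : j ≤ k) (hx : G.Adj (p i) (c x)) (hy : G.Adj (p j) (c y)) (hm : j - i + 2 < k) :
    (x ≤ y → y ≤ x + n → y - x ≤ j - i + 2 ∨ x + n - y ≤ j - i + 2) ∧
      (y ≤ x → x ≤ y + n → x - y ≤ j - i + 2 ∨ y + n - x ≤ j - i + 2) :=
  h.dist_of_walk hm
    ((((WalkWithin.of_adj hx.symm).trans (h.walk hi hij hj)).trans (.of_adj hy)).mono (by omega))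

theorem dist_start_of_adj (h : Shortcut G n k d c p) {i x : ℤ} (hi : 0 ≤ i)
    (hik : i + 1 < k) (hx : G.Adj (p i) (c x)) :
    (0 ≤ x → x ≤ n → x ≤ i + 1 ∨ n - x ≤ i + 1) := by
  have w := h.walk le_rfl hi (by omega)
  rw [h.start_eq] at w
  have := h.dist_of_walk (m := i + 1) (by omega) ((w.trans (.of_adj hx)).mono (by omega))
  omega

theorem dist_end_of_adj (h : Shortcut G n k d c p) {i x : ℤ} (hi : 1 < i)
    (hik : i ≤ k) (hx : G.Adj (p i) (c x)) :
    (x ≤ d → d ≤ x + n → d - x ≤ k - i + 1 ∨ x + n - d ≤ k - i + 1) ∧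
      (d ≤ x → x ≤ d + n → x - d ≤ k - i + 1 ∨ d + n - x ≤ k - i + 1) := by
  have w := h.walk (show 0 ≤ i by omega) hik le_rfl
  rw [h.end_eq] at w
  exact h.dist_of_walk (by omega) (((WalkWithin.of_adj hx.symm).trans w).mono (by omega))

theorem exists_window (h : Shortcut G n k d c p) (x : ℤ) : ∃ y, 0 ≤ y ∧ y < n ∧ c x = c y := by
  have := h.lt
  have := h.two_mul_lt
  have := h.nonneg
  exact h.cycle.exists_window (by omega) x

theorem off_cycle (h : Shortcut G n k d c p) {i : ℤ} (hi : 0 < i) (hik : i < k) (x : ℤ) :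
    p i ≠ c x := by
  intro heq
  have := h.lt
  have := h.two_mul_lt
  obtain ⟨y, hy, hyn, hxy⟩ := h.exists_window x
  have w1 := h.walk le_rfl hi.le hik.le
  have w2 := h.walk hi.le hik.le le_rfl
  rw [heq, hxy, h.start_eq] at w1
  rw [heq, hxy, h.end_eq] at w2
  have h1 := h.dist_of_walk (by omega) w1
  have h2 := h.dist_of_walk (by omega) w2
  omega

theorem exists_attachment (h : Shortcut G n k d c p) {i z : ℤ} (hi : 0 < i) (hik : i < k)
    (hz : G.Adj (p i) (c z)) :
    ∃ s, z - 1 ≤ s ∧ s ≤ z + 1 ∧ ∀ x, s + 2 ≤ x → x ≤ s + n - 2 → ¬ G.Adj (p i) (c x) := by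
  have := h.lt
  have := h.two_mul_lt
  have hn : 0 < n := by omega
  obtain ⟨s, hs⟩ := h.clean (p i) (h.off_cycle hi hik)
  have hr := Int.emod_nonneg (s - z + 1) hn.ne'
  have hl := Int.emod_lt_of_pos (s - z + 1) hn
  have e := Int.emod_add_mul_ediv (s - z + 1) n
  generalize (s - z + 1) % n = r at *
  generalize (s - z + 1) / n = t at *
  have hs' : ∀ x, z - 1 + r + 2 ≤ x → x ≤ z - 1 + r + n - 2 → ¬ G.Adj (p i) (c x) := by
    intro x hx hx'
    rw [← h.cycle.add_mul_period x t, mul_comm]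
    exact hs _ (by omega) (by omega)
  by_cases hr2 : r ≤ 2
  · exact ⟨z - 1 + r, by omega, by omega, hs'⟩
  · refine (hs' (z + n) (by omega) (by omega) ?_).elim
    rwa [h.cycle.1]

theorem three_le (h : Shortcut G n k d c p) : 3 ≤ k := by
  have h1 := h.lt
  have h2 := h.two_mul_lt
  have h3 := h.nonneg
  by_contra hlt
  have hk : k = 0 ∨ k = 1 ∨ k = 2 := by omega
  rcases hk with rfl | rfl | rfl
  · exact (h.cycle.2 0 d (by omega) (by omega)).1 (h.start_eq.symm.trans h.end_eq)
  · have := h.adj 0 le_rfl (by omega)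
    rw [zero_add, h.start_eq, h.end_eq, (h.cycle.2 0 d (by omega) (by omega)).2] at this
    omega
  · have ha := (h.adj 0 le_rfl (by omega)).symm
    have hb := h.adj 1 (by omega) (by omega)
    rw [h.start_eq, zero_add] at ha
    rw [show (1 : ℤ) + 1 = 2 by norm_num, h.end_eq] at hb
    obtain ⟨s, hs1, hs2, hs⟩ := h.exists_attachment (by omega) (by omega) ha
    exact hs d (by omega) (by omega) hb

theorem adj_start (h : Shortcut G n k d c p) : G.Adj (p 1) (c 0) := by
  have := h.three_le
  have := h.adj 0 le_rfl (by omega)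
  rw [h.start_eq, zero_add] at this
  exact this.symm

theorem exists_startArc (h : Shortcut G n k d c p) : ∃ α α', StartArc G n c p α α' := by
  have h1 := h.lt
  have h2 := h.two_mul_lt
  have h3 := h.three_le
  have h0 := h.adj_start
  obtain ⟨s, hs1, hs2, hs⟩ := h.exists_attachment (by omega) (by omega) h0
  have extend : ∀ β γ : ℤ, (∀ x, β < x → x < γ → ¬ G.Adj (p 1) (c x)) → 0 < β →
      ¬ G.Adj (p 1) (c β) → ∀ x, β - 1 < x → x < γ → ¬ G.Adj (p 1) (c x) := by
    intro β γ hβ _ hna x hx hx'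
    rcases eq_or_lt_of_le (show β ≤ x by omega) with rfl | hlt
    · exact hna
    · exact hβ x hlt hx'
  have shrink : ∀ b : ℕ, ∀ γ : ℤ, (∀ x, (b : ℤ) < x → x < γ → ¬ G.Adj (p 1) (c x)) →
      ∃ α : ℤ, 0 ≤ α ∧ α ≤ b ∧ G.Adj (p 1) (c α) ∧
        ∀ x, α < x → x < γ → ¬ G.Adj (p 1) (c x) := by
    intro b γ
    induction b with
    | zero => exact fun hb => ⟨0, le_rfl, le_rfl, h0, hb⟩
    | succ b ih =>
      intro hb
      by_cases hadj : G.Adj (p 1) (c ((b + 1 : ℕ) : ℤ))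
      · exact ⟨_, by omega, le_rfl, hadj, hb⟩
      · obtain ⟨α, e1, e2, e3, e4⟩ := ih (fun x hx hx' => by
          have := extend _ γ hb (by omega) hadj
          exact this x (by push_cast; omega) hx')
        exact ⟨α, e1, by push_cast; omega, e3, e4⟩
  have shrink' : ∀ b : ℕ, ∀ β : ℤ, (∀ x, β < x → x < n - b → ¬ G.Adj (p 1) (c x)) →
      ∃ α' : ℤ, 0 ≤ α' ∧ α' ≤ b ∧ G.Adj (p 1) (c (-α')) ∧
        ∀ x, β < x → x < n - α' → ¬ G.Adj (p 1) (c x) := by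
    intro b β
    induction b with
    | zero => exact fun hb => ⟨0, le_rfl, le_rfl, by simpa using h0, by simpa using hb⟩
    | succ b ih =>
      intro hb
      by_cases hadj : G.Adj (p 1) (c (-((b + 1 : ℕ) : ℤ)))
      · exact ⟨_, by omega, le_rfl, hadj, hb⟩
      · obtain ⟨α, e1, e2, e3, e4⟩ := ih (fun x hx hx' => by
          rcases eq_or_lt_of_le (show x ≤ n - (b + 1 : ℕ) by push_cast; omega) with rfl | hlt
          · rwa [← h.cycle.sub_period, show n - ((b + 1 : ℕ) : ℤ) - n = -((b + 1 : ℕ) : ℤ) by ring]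
          · exact hb x hx hlt)
        exact ⟨α, e1, by push_cast; omega, e3, e4⟩
  obtain ⟨α, a1, a2, a3, a4⟩ := shrink (s + 1).toNat (s + n - 1)
    (fun x hx hx' => hs x (by omega) (by omega))
  obtain ⟨α', b1, b2, b3, b4⟩ := shrink' (1 - s).toNat α
    (fun x hx hx' => a4 x hx (by omega))
  exact ⟨α, α', a1, b1, by omega, a3, b3, b4⟩

/-- Attachments of the middle vertices of the walk. -/
theorem mid_adj (h : Shortcut G n k d c p) {i x : ℤ} (hi : 2 ≤ i) (hik : i ≤ k - 2) (hx : 0 ≤ x)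
    (hxn : x < n) (hadj : G.Adj (p i) (c x)) :
    (d = k + 1 ∧ (x = i ∨ x = i + 1)) ∨ (d = k + 2 ∧ x = i + 1) ∨
      (d = k + 1 ∧ n = 2 * k + 3 ∧ x = n - (i + 1)) := by
  have h1 := h.lt
  have h2 := h.two_mul_lt
  have h3 := h.dist_start_of_adj (by omega) (by omega) hadj
  have h4 := h.dist_end_of_adj (by omega) (by omega) hadj
  omega

theorem adj_short_arc (h : Shortcut G n k d c p) (hd : d = k + 1) {i x : ℤ} (hi : 0 ≤ i)
    (hik : i ≤ k) (hx : 1 ≤ x) (hxk : x ≤ k) (hadj : G.Adj (p i) (c x)) : x = i ∨ x = i + 1 := by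
  have h2 := h.two_mul_lt
  have h3 := h.three_le
  have hcases : i = 0 ∨ i = 1 ∨ (2 ≤ i ∧ i ≤ k - 2) ∨ i = k - 1 ∨ i = k := by omega
  rcases hcases with rfl | rfl | hmid | rfl | rfl
  · rw [h.start_eq, (h.cycle.2 0 x (by omega) (by omega)).2] at hadj
    omega
  · obtain ⟨s, hs1, hs2, hs⟩ := h.exists_attachment (by omega) (by omega) h.adj_start
    by_contra hne
    exact hs x (by omega) (by omega) hadj
  · have := h.mid_adj hmid.1 hmid.2 (by omega) (by omega) hadj
    omega
  · have ha := h.reverse.adj_start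
    simp only [sub_zero] at ha
    obtain ⟨s, hs1, hs2, hs⟩ := h.exists_attachment (by omega) (by omega) ha
    by_contra hne
    refine hs (x + n) (by omega) (by omega) ?_
    rwa [h.cycle.1]
  · rw [h.end_eq, G.adj_comm, (h.cycle.2 x d (by omega) (by omega)).2] at hadj
    omega

theorem ne_short_arc (h : Shortcut G n k d c p) {i x : ℤ} (hi : 0 ≤ i)
    (hik : i ≤ k) (hx : 1 ≤ x) (hxk : x < d) : p i ≠ c x := by
  have h2 := h.two_mul_lt
  have hcases : i = 0 ∨ (0 < i ∧ i < k) ∨ i = k := by omega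
  rcases hcases with rfl | hmid | rfl
  · rw [h.start_eq]
    exact (h.cycle.2 0 x (by omega) (by omega)).1
  · exact h.off_cycle hmid.1 hmid.2 x
  · rw [h.end_eq]
    exact (h.cycle.2 x d (by omega) (by omega)).1.symm

theorem mid_not_adj_long_arc (h : Shortcut G n k d c p) {i x : ℤ} (hi : 2 ≤ i) (hik : i ≤ k - 2)
    (hx : d < x) (hxn : x < n) : ¬ G.Adj (p i) (c x) := by
  intro hadj
  have h1 := h.lt
  have h2 := h.two_mul_lt
  have h3 := h.three_le
  have hm := h.mid_adj hi hik (by omega) hxn hadj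
  have hd : d = k + 1 := by omega
  have hno : ∀ j y, 0 < j → j < k → 1 ≤ y → y ≤ k → ¬ G.Adj (p j) (c y) := by
    intro j y hj hjk hy hyk hjy
    have h4 := h.adj_short_arc hd hj.le hjk.le hy hyk hjy
    rcases le_total j i with hji | hji
    · have := h.dist_of_adj_adj hj.le hji (by omega) hjy hadj (by omega)
      omega
    · have := h.dist_of_adj_adj (by omega) hji (by omega) hadj hjy (by omega)
      omega
  obtain ⟨D, hD, -, -⟩ := InducedCycle.of_paths (s := 0) (t := k) (u := -k) (v := -1)
    (by omega) (by omega) h.path ((h.cycle.reflect 0).path (by omega)) (by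
      intro a b ha hak hb hb'
      refine ⟨h.ne_short_arc ha hak (by omega) (by omega), ?_⟩
      have hcases : a = 0 ∨ (0 < a ∧ a < k) ∨ a = k := by omega
      rcases hcases with rfl | hmid | rfl
      · rw [h.start_eq, (h.cycle.2 0 (0 - b) (by omega) (by omega)).2]
        omega
      · simp only [hno a (0 - b) hmid.1 hmid.2 (by omega) (by omega), false_iff]
        omega
      · rw [h.end_eq, G.adj_comm, (h.cycle.2 (0 - b) d (by omega) (by omega)).2]
        omega)
  obtain ⟨e, he⟩ := h.even_of_lt _ D hD (by omega) (by omega)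
  omega

end Shortcut

namespace Shortcut

variable {G : SimpleGraph V} {n k d : ℤ} {c p : ℤ → V}

theorem even_long_cycle (h : Shortcut G n k d c p) {α α' β β' : ℤ} (hα : StartArc G n c p α α')
    (hβ : StartArc G n (fun x => c (d - x)) (fun i => p (k - i)) β β') :
    Even (k + n - d - α' - β') := by
  have h1 := h.lt
  have h2 := h.two_mul_lt
  have h3 := h.three_le
  have ha1 := hα.nonneg
  have ha2 := hα.nonneg'
  have ha3 := hα.le
  have hb1 := hβ.nonneg
  have hb2 := hβ.nonneg'
  have hb3 := hβ.le
  obtain ⟨D, hD, -, -⟩ := InducedCycle.of_paths (s := 1) (t := k - 1) (u := d + β')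
    (v := n - α') (by omega) (by omega) (h.path.mono (by omega) (by omega))
    (h.cycle.path (by omega)) (by
      intro i x hi hik hx hx'
      refine ⟨h.off_cycle (by omega) (by omega) x, ?_⟩
      have hi1 : i = 1 → (G.Adj (p i) (c x) ↔ x = n - α') := by
        rintro rfl
        by_cases hxe : x = n - α'
        · simp only [hxe, iff_true]
          rw [← h.cycle.sub_period, show n - α' - n = -α' by ring]
          exact hα.adj'
        · simp only [hxe, iff_false]
          exact hα.not_adj x (by omega) (by omega)
      have hik1 : i = k - 1 → (G.Adj (p i) (c x) ↔ x = d + β') := by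
        rintro rfl
        by_cases hxe : x = d + β'
        · subst hxe
          simpa using hβ.adj'
        · simp only [hxe, iff_false]
          have := hβ.not_adj (d + n - x) (by omega) (by omega)
          rwa [show d - (d + n - x) = x - n by ring, h.cycle.sub_period] at this
      by_cases hi1' : i = 1
      · rw [hi1 hi1']
        omega
      by_cases hik1' : i = k - 1
      · rw [hik1 hik1']
        omega
      · have hna : ¬ G.Adj (p i) (c x) := by
          rcases eq_or_lt_of_le (show x ≤ n by omega) with rfl | hlt
          · intro hadj
            have e := h.cycle.1 0
            rw [zero_add] at e
            rw [e] at hadj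
            have := h.mid_adj (by omega) (by omega) le_rfl (by omega) hadj
            omega
          rcases eq_or_lt_of_le (show d ≤ x by omega) with rfl | hlt'
          · intro hadj
            have := h.mid_adj (by omega) (by omega) (by omega) (by omega) hadj
            omega
          · exact h.mid_not_adj_long_arc (by omega) (by omega) hlt' hlt
        simp only [hna, false_iff]
        omega)
  have := h.even_of_lt _ D hD (by omega) (by omega)
  rwa [show k - 1 - 1 + 1 + (n - α' - (d + β') + 1) = k + n - d - α' - β' by ring] at this

theorem even_short_cycle (h : Shortcut G n k d c p) {α α' β β' : ℤ} (hα : StartArc G n c p α α')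
    (hβ : StartArc G n (fun x => c (d - x)) (fun i => p (k - i)) β β')
    (hmid : ∀ i x, 2 ≤ i → i ≤ k - 2 → ¬ G.Adj (p i) (c x)) (hαβ : α + β < d) :
    Even (k + d - α - β) := by
  have h1 := h.lt
  have h2 := h.two_mul_lt
  have h3 := h.three_le
  have ha1 := hα.nonneg
  have ha2 := hα.nonneg'
  have ha3 := hα.le
  have hb1 := hβ.nonneg
  have hb2 := hβ.nonneg'
  have hb3 := hβ.le
  obtain ⟨D, hD, -, -⟩ := InducedCycle.of_paths (s := 1) (t := k - 1) (u := β)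
    (v := d - α) (by omega) (by omega) (h.path.mono (by omega) (by omega))
    ((h.cycle.reflect d).path (by omega)) (by
      intro i x hi hik hx hx'
      refine ⟨h.off_cycle (by omega) (by omega) _, ?_⟩
      have hi1 : i = 1 → (G.Adj (p i) (c (d - x)) ↔ x = d - α) := by
        rintro rfl
        by_cases hxe : x = d - α
        · simpa [hxe] using hα.adj
        · simp only [hxe, iff_false]
          exact hα.not_adj _ (by omega) (by omega)
      have hik1 : i = k - 1 → (G.Adj (p i) (c (d - x)) ↔ x = β) := by
        rintro rfl
        by_cases hxe : x = β
        · subst hxe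
          simpa using hβ.adj
        · simp only [hxe, iff_false]
          exact hβ.not_adj x (by omega) (by omega)
      by_cases hi1' : i = 1
      · rw [hi1 hi1']
        omega
      by_cases hik1' : i = k - 1
      · rw [hik1 hik1']
        omega
      · simp only [hmid i (d - x) (by omega) (by omega), false_iff]
        omega)
  have := h.even_of_lt _ D hD (by omega) (by omega)
  rwa [show k - 1 - 1 + 1 + (d - α - β + 1) = k + d - α - β by ring] at this

theorem startArc_sum_ne_one (h : Shortcut G n k d c p) {α α' β β' : ℤ}
    (hα : StartArc G n c p α α')
    (hβ : StartArc G n (fun x => c (d - x)) (fun i => p (k - i)) β β')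
    (hmid : ∀ i x, 2 ≤ i → i ≤ k - 2 → ¬ G.Adj (p i) (c x)) (hβ1 : β + β' ≠ 1) :
    α + α' ≠ 1 := by
  intro hα1
  have h1 := h.lt
  have h2 := h.two_mul_lt
  have h3 := h.three_le
  have ha1 := hα.nonneg
  have ha2 := hα.nonneg'
  have hb1 := hβ.nonneg
  have hb2 := hβ.nonneg'
  have hb3 := hβ.le
  have hD := h.cycle.shift (-α')
  have hq := (h.path.mono (show 0 ≤ 1 by norm_num) (show k - 1 ≤ k by omega)).shift 1
  rw [show (1 : ℤ) - 1 = 0 by norm_num, show k - 1 - 1 = k - 2 by ring] at hq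
  have hdisj : ∀ t x, 0 ≤ t → t ≤ k - 2 → p (1 + t) ≠ c (-α' + x) := fun t x _ _ =>
    h.off_cycle (by omega) (by omega) _
  have e0 : G.Adj (p (1 + 0)) (c (-α' + 0)) := by simpa using hα.adj'
  have e1 : G.Adj (p (1 + 0)) (c (-α' + 1)) := by
    rw [show -α' + 1 = α by omega, add_zero]
    exact hα.adj
  have e2 : ∀ x, 1 < x → x < n → ¬ G.Adj (p (1 + 0)) (c (-α' + x)) := by
    intro x hx hxn
    rw [add_zero]
    exact hα.not_adj _ (by omega) (by omega)
  have hm : ∀ t x, 0 < t → t < k - 2 → ¬ G.Adj (p (1 + t)) (c (-α' + x)) := fun t x _ _ =>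
    hmid _ _ (by omega) (by omega)
  have hend : G.Adj (p (1 + (k - 2))) (c (d - β)) := by
    rw [show 1 + (k - 2) = k - 1 by ring]
    exact hβ.adj
  have hend' : G.Adj (p (1 + (k - 2))) (c (d + β')) := by
    rw [show 1 + (k - 2) = k - 1 by ring]
    simpa using hβ.adj'
  have hend_not : ∀ x, d + β' < x → x < d - β + n → ¬ G.Adj (p (1 + (k - 2))) (c x) := by
    intro x hx hx'
    have := hβ.not_adj (d + n - x) (by omega) (by omega)
    rw [show 1 + (k - 2) = k - 1 by ring]
    rwa [show d - (d + n - x) = x - n by ring, h.cycle.sub_period] at this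
  have hcases : (β = 0 ∧ β' = 0) ∨ β + β' = 2 := by omega
  rcases hcases with ⟨rfl, rfl⟩ | hβ2
  · refine h.no_pyramid (hD.containsPyramid_of_single (by omega) (by omega) hq hdisj e0 e1 e2 hm
      (y := d + α') (by omega) (by omega) ?_ fun x hx hx' => hend_not _ (by omega) (by omega))
    simpa using hend
  · refine h.no_pyramid (hD.containsPyramid_of_double (by omega) hq hdisj e0 e1 e2 hm
      (y := d - β + 1 + α') (by omega) (by omega) ?_ ?_
      fun x hx hx' => hend_not _ (by omega) (by omega))
    · simpa [show -α' + (d - β + 1 + α' - 1) = d - β by ring] using hend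
    · simpa [show -α' + (d - β + 1 + α' + 1) = d + β' by omega] using hend'

/-- If no middle vertex of the walk attaches to the hole, there is a short odd hole or a pyramid. -/
theorem false_of_mid_not_adj (h : Shortcut G n k d c p) {α α' β β' : ℤ}
    (hα : StartArc G n c p α α')
    (hβ : StartArc G n (fun x => c (d - x)) (fun i => p (k - i)) β β')
    (hmid : ∀ i x, 2 ≤ i → i ≤ k - 2 → ¬ G.Adj (p i) (c x)) (hαβ : α + β < d) : False := by
  have ha1 := hα.nonneg
  have ha2 := hα.nonneg'
  have ha3 := hα.le
  have hb1 := hβ.nonneg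
  have hb2 := hβ.nonneg'
  have hb3 := hβ.le
  obtain ⟨a, ha⟩ := h.even_long_cycle hα hβ
  obtain ⟨b, hb⟩ := h.even_short_cycle hα hβ hmid hαβ
  obtain ⟨e, he⟩ := h.odd
  by_cases hβ1 : β + β' = 1
  · refine h.reverse.startArc_sum_ne_one (α := β) (α' := β') (β := α) (β' := α') hβ
      (by simpa using hα) (fun i x hi hik => hmid _ _ (by omega) (by omega)) (by omega) hβ1
  · exact h.startArc_sum_ne_one hα hβ hmid hβ1 (by omega)

/-- Either no middle vertex of the walk attaches to the hole, or the walk is one shorter than the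
short arc and attaches to that arc only. -/
theorem mid_not_adj_or (h : Shortcut G n k d c p) {α α' β β' : ℤ}
    (hα : StartArc G n c p α α')
    (hβ : StartArc G n (fun x => c (d - x)) (fun i => p (k - i)) β β') :
    ((∀ i x, 2 ≤ i → i ≤ k - 2 → ¬ G.Adj (p i) (c x)) ∧ α + β < d) ∨
      (d = k + 1 ∧ α' = 0 ∧ β' = 0) := by
  have h1 := h.lt
  have h2 := h.two_mul_lt
  have h3 := h.three_le
  have ha1 := hα.nonneg
  have ha2 := hα.nonneg'
  have ha3 := hα.le
  have hb1 := hβ.nonneg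
  have hb2 := hβ.nonneg'
  have hb3 := hβ.le
  obtain ⟨a, ha⟩ := h.even_long_cycle hα hβ
  obtain ⟨e, he⟩ := h.odd
  by_cases hc : d = k + 1 ∧ α' = 0 ∧ β' = 0
  · exact Or.inr hc
  refine Or.inl ⟨fun i z hi hik hadj => ?_, by omega⟩
  obtain ⟨x, hx, hxn, hzx⟩ := h.exists_window z
  rw [hzx] at hadj
  have hm := h.mid_adj hi hik hx hxn hadj
  have hα' := h.dist_of_adj_adj (by omega) (by omega) (by omega) hα.adj' hadj (by omega)
  have hb' := hβ.adj'
  rw [sub_neg_eq_add] at hb'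
  have hβ' := h.dist_of_adj_adj (by omega) (by omega) (by omega) hadj hb' (by omega)
  have hlong : x ≤ d := by
    by_contra hlt
    exact h.mid_not_adj_long_arc hi hik (by omega) hxn hadj
  omega

end Shortcut

namespace Shortcut

variable {G : SimpleGraph V} {n k d : ℤ} {c p : ℤ → V}

/-- There is no odd face between the walk and the short arc. -/
theorem false_of_odd_face (h : Shortcut G n k d c p) (hd : d = k + 1) {i j a b : ℤ} (hi : 0 ≤ i)
    (hij : i ≤ j) (hj : j ≤ k) (ha : 1 ≤ a) (hab : a ≤ b) (hb : b ≤ k)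
    (hia : G.Adj (p i) (c a)) (hjb : G.Adj (p j) (c b))
    (hno : ∀ l y, i ≤ l → l ≤ j → a ≤ y → y ≤ b → G.Adj (p l) (c y) →
      (l = i ∧ y = a) ∨ (l = j ∧ y = b))
    (hodd : Odd (j - i + (b - a))) (hlen : 2 ≤ j - i + (b - a)) : False := by
  have h2 := h.two_mul_lt
  obtain ⟨D, hD, -, -⟩ := InducedCycle.of_paths (s := i) (t := j) (u := -b) (v := -a)
    hij (by omega) (h.path.mono hi hj) ((h.cycle.reflect 0).path (by omega)) (by
      intro l y hl hl' hy hy'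
      refine ⟨h.ne_short_arc (by omega) (by omega) (by omega) (by omega), fun hadj => ?_, ?_⟩
      · have := hno l (0 - y) hl hl' (by omega) (by omega) hadj
        omega
      · rintro (⟨rfl, rfl⟩ | ⟨rfl, rfl⟩)
        · simpa using hjb
        · simpa using hia)
  obtain ⟨e, he⟩ := h.even_of_lt _ D hD (by omega) (by omega)
  obtain ⟨e', he'⟩ := hodd
  omega

theorem adj_first_arc (h : Shortcut G n k d c p) : G.Adj (p 0) (c 1) := by
  have := h.lt
  have := h.two_mul_lt
  have := h.three_le
  rw [h.start_eq]
  exact h.cycle.adj_succ (by omega) 0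

theorem adj_last_arc (h : Shortcut G n k d c p) (hd : d = k + 1) : G.Adj (p k) (c k) := by
  have := h.two_mul_lt
  have := h.three_le
  rw [h.end_eq, hd]
  exact (h.cycle.adj_succ (by omega) k).symm

/-- The transition from rungs `p i — c (i + 1)` to rungs `p j — c j` happens at a triangle. -/
theorem exists_triangle (h : Shortcut G n k d c p) (hd : d = k + 1) (r : ℕ) :
    ∀ i j : ℤ, 0 ≤ i → i < j → j ≤ k → j - i ≤ r → G.Adj (p i) (c (i + 1)) → G.Adj (p j) (c j) →
      ∃ l, i ≤ l ∧ l < j ∧ G.Adj (p l) (c (l + 1)) ∧ G.Adj (p (l + 1)) (c (l + 1)) := by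
  induction r with
  | zero => intro i j _ _ _ _; omega
  | succ r ih =>
    intro i j hi hij hj hr hB hA
    by_cases hA' : ∃ l, i < l ∧ l < j ∧ G.Adj (p l) (c l)
    · obtain ⟨l, hil, hlj, hl⟩ := hA'
      obtain ⟨l', e1, e2, e3⟩ := ih i l hi hil (by omega) (by omega) hB hl
      exact ⟨l', e1, by omega, e3⟩
    by_cases hB' : ∃ l, i < l ∧ l < j ∧ G.Adj (p l) (c (l + 1))
    · obtain ⟨l, hil, hlj, hl⟩ := hB'
      obtain ⟨l', e1, e2, e3⟩ := ih l j (by omega) hlj hj (by omega) hl hA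
      exact ⟨l', by omega, e2, e3⟩
    by_cases hj1 : j = i + 1
    · subst hj1
      exact ⟨i, le_rfl, by omega, hB, hA⟩
    push Not at hA' hB'
    refine (h.false_of_odd_face hd hi hij.le hj (by omega) (by omega) hj hB hA ?_
      ⟨j - i - 1, by ring⟩ (by omega)).elim
    intro l y hl hl' hy hy' hadj
    rcases h.adj_short_arc hd (by omega) (by omega) (by omega) (by omega) hadj with rfl | rfl
    · by_contra hne
      exact hA' y (by omega) (by omega) hadj
    · by_contra hne
      exact hB' l (by omega) (by omega) hadj

/-- The cycle formed by the walk and the long arc, and its attachments to the short arc. -/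
theorem exists_long_cycle (h : Shortcut G n k d c p) (hd : d = k + 1)
    (hlong : ∀ i x, 0 < i → i < k → d < x → x < n → ¬ G.Adj (p i) (c x)) :
    ∃ D, InducedCycle G (n - 1) D ∧ (∀ x, 0 ≤ x → x ≤ k → D x = p x) ∧
      (∀ y z, 1 ≤ y → y ≤ k → c y ≠ D z) ∧
      ∀ y x, 1 ≤ y → y ≤ k → 0 ≤ x → x < n - 1 → G.Adj (c y) (D x) →
        x ≤ k ∧ (y = x ∨ y = x + 1) := by
  have h2 := h.two_mul_lt
  have h3 := h.three_le
  obtain ⟨D, hD, hD1, hD2⟩ := InducedCycle.of_paths (s := 0) (t := k) (u := k + 2) (v := n - 1)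
    (by omega) (by omega) h.path (h.cycle.path (by omega)) (by
      intro i x hi hik hx hx'
      have hcases : i = 0 ∨ (0 < i ∧ i < k) ∨ i = k := by omega
      rcases hcases with rfl | hmid | rfl
      · rw [h.start_eq]
        have := h.cycle.2 0 x (by omega) (by omega)
        refine ⟨this.1, this.2.trans ?_⟩
        omega
      · refine ⟨h.off_cycle hmid.1 hmid.2 x, ?_⟩
        simp only [hlong i x hmid.1 hmid.2 (by omega) (by omega), false_iff]
        omega
      · rw [h.end_eq]
        have := h.cycle.2 d x (by omega) (by omega)
        refine ⟨this.1, this.2.trans ?_⟩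
        omega)
  rw [show k - 0 + 1 + (n - 1 - (k + 2) + 1) = n - 1 by ring] at hD
  have hD3 : ∀ x, k < x → x < n - 1 → D x = c (x + 1) := fun x hx hx' => by
    rw [← hD2 (x + 1) (by omega) (by omega)]
    congr 1
    ring
  refine ⟨D, hD, hD1, fun y z hy hyk => ?_, fun y x hy hyk hx hxn hadj => ?_⟩
  · obtain ⟨x, hx, hxn, hzx⟩ := hD.exists_window (by omega) z
    rw [hzx]
    by_cases hxk : x ≤ k
    · rw [hD1 x hx hxk]
      exact (h.ne_short_arc hx hxk hy (by omega)).symm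
    · rw [hD3 x (by omega) hxn]
      exact (h.cycle.2 y (x + 1) (by omega) (by omega)).1
  · by_cases hxk : x ≤ k
    · rw [hD1 x hx hxk] at hadj
      exact ⟨hxk, h.adj_short_arc hd hx hxk hy hyk hadj.symm⟩
    · rw [hD3 x (by omega) hxn, (h.cycle.2 y (x + 1) (by omega) (by omega)).2] at hadj
      omega

/-- A triangle `p i, p (i + 1), c (i + 1)` is followed by a triangle
`p (i + 1), c (i + 1), c (i + 2)`. -/
theorem adj_next (h : Shortcut G n k d c p) (hd : d = k + 1)
    (hlong : ∀ i x, 0 < i → i < k → d < x → x < n → ¬ G.Adj (p i) (c x)) {i : ℤ} (hi : 0 ≤ i)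
    (hik : i + 1 < k) (hB : G.Adj (p i) (c (i + 1))) (hA : G.Adj (p (i + 1)) (c (i + 1))) :
    G.Adj (p (i + 1)) (c (i + 1 + 1)) := by
  have h2 := h.two_mul_lt
  by_contra hB'
  obtain ⟨j, ⟨hij, hjk, hj⟩, hmin⟩ := Int.exists_least_of_bdd
    (P := fun j => i + 1 < j ∧ j ≤ k ∧ (G.Adj (p j) (c j) ∨ (j < k ∧ G.Adj (p j) (c (j + 1)))))
    ⟨i + 1, fun z hz => hz.1.le⟩ ⟨k, hik, le_rfl, Or.inl (h.adj_last_arc hd)⟩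
  have hA0 : ∀ l, i + 1 < l → l < j → ¬ G.Adj (p l) (c l) := fun l hl hlj hadj => by
    have := hmin l ⟨hl, by omega, Or.inl hadj⟩
    omega
  have hB0 : ∀ l, i < l → l < j → ¬ G.Adj (p l) (c (l + 1)) := fun l hl hlj hadj => by
    rcases eq_or_lt_of_le (show i + 1 ≤ l by omega) with rfl | hl'
    · exact hB' hadj
    · have := hmin l ⟨hl', by omega, Or.inr ⟨by omega, hadj⟩⟩
      omega
  by_cases hAj : G.Adj (p j) (c j)
  · obtain ⟨D, hD, hD1, hne, hadjD⟩ := h.exists_long_cycle hd hlong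
    have hcD : ∀ y x, i + 1 ≤ y → y ≤ j → 0 ≤ x → x < n - 1 → G.Adj (c y) (D x) →
        (y = i + 1 ∧ (x = i ∨ x = i + 1)) ∨ (y = j ∧ x = j) := by
      intro y x hy hyj hx hxn hadj
      obtain ⟨hxk, hyx⟩ := hadjD y x (by omega) (by omega) hx hxn hadj
      rw [hD1 x hx hxk, G.adj_comm] at hadj
      rcases hyx with rfl | rfl
      · by_contra hcon
        exact hA0 y (by omega) (by omega) hadj
      · by_contra hcon
        exact hB0 x (by omega) (by omega) hadj
    have hcD' : ∀ y x, i + 1 ≤ y → y ≤ j → 0 ≤ x → x < 2 * (n - 1) → G.Adj (c y) (D x) →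
        (y = i + 1 ∧ (x = i ∨ x = i + 1 ∨ x = i + (n - 1) ∨ x = i + 1 + (n - 1))) ∨
          (y = j ∧ (x = j ∨ x = j + (n - 1))) := by
      intro y x hy hyj hx hxn hadj
      by_cases hlt : x < n - 1
      · have := hcD y x hy hyj hx hlt hadj
        omega
      · rw [← hD.sub_period] at hadj
        have := hcD y _ hy hyj (by omega) (by omega) hadj
        omega
    have hq := ((h.cycle.path (s := i + 1) (e := j) (by omega)).shift (i + 1))
    rw [show i + 1 - (i + 1) = 0 by ring] at hq
    refine h.no_pyramid ((hD.shift i).containsPyramid_of_single (y := j - i) (by omega)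
      (by omega) hq (fun t x ht htr => hne _ _ (by omega) (by omega)) ?_ ?_ ?_ ?_
      (by omega) (by omega) ?_ ?_)
    · rw [add_zero, add_zero, hD1 i hi (by omega)]
      exact hB.symm
    · rw [add_zero, hD1 (i + 1) (by omega) (by omega)]
      exact hA.symm
    · intro x hx hx' hadj
      have := hcD' _ _ (by omega) (by omega) (by omega) (by omega) hadj
      omega
    · intro t z ht ht' hadj
      obtain ⟨x, hx, hxn, hzx⟩ := hD.exists_window (by omega) (i + z)
      rw [hzx] at hadj
      have := hcD _ x (by omega) (by omega) hx hxn hadj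
      omega
    · rw [show i + 1 + (j - (i + 1)) = j by ring, show i + (j - i) = j by ring,
        hD1 j (by omega) hjk]
      exact hAj.symm
    · intro x hx hx' hadj
      have := hcD' _ _ (by omega) (by omega) (by omega) (by omega) hadj
      omega
  · obtain ⟨hjk', hBj⟩ := hj.resolve_left hAj
    refine h.false_of_odd_face hd (by omega) (by omega) hjk (by omega) (by omega) (by omega) hA hBj
      ?_ ⟨j - (i + 1), by ring⟩ (by omega)
    intro l y hl hl' hy hy' hadj
    rcases h.adj_short_arc hd (by omega) (by omega) (by omega) (by omega) hadj with rfl | rfl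
    · by_contra hcon
      rcases eq_or_lt_of_le hl' with rfl | hlj
      · exact hAj hadj
      · exact hA0 y (by omega) hlj hadj
    · by_contra hcon
      exact hB0 l (by omega) (by omega) hadj

/-- Every rung `p i — c (i + 1)` starts a triangle `p i, p (i + 1), c (i + 1)`. -/
theorem adj_succ_of_adj (h : Shortcut G n k d c p) (hd : d = k + 1)
    (hlong : ∀ i x, 0 < i → i < k → d < x → x < n → ¬ G.Adj (p i) (c x)) {i : ℤ} (hi : 0 ≤ i)
    (hik : i < k) (hB : G.Adj (p i) (c (i + 1))) : G.Adj (p (i + 1)) (c (i + 1)) := by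
  have h2 := h.two_mul_lt
  obtain ⟨l, ⟨hil, hlk, hl1, hl2⟩, hmin⟩ := Int.exists_least_of_bdd
    (P := fun l => i ≤ l ∧ l < k ∧ G.Adj (p l) (c (l + 1)) ∧ G.Adj (p (l + 1)) (c (l + 1)))
    ⟨i, fun z hz => hz.1⟩
    (h.exists_triangle hd (k - i).toNat i k hi hik le_rfl (by omega) hB (h.adj_last_arc hd))
  rcases eq_or_lt_of_le hil with rfl | hlt
  · exact hl2
  have hA : G.Adj (p l) (c l) := by
    have := h.reverse.adj_next hd
      (fun j x hj hjk hx hxn hadj => by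
        rw [← h.cycle.1] at hadj
        exact hlong (k - j) (d - x + n) (by omega) (by omega) (by omega) (by omega) hadj)
      (i := k - 1 - l) (by omega) (by omega)
      (by
        rw [show k - (k - 1 - l) = l + 1 by ring, show d - (k - 1 - l + 1) = l + 1 by omega]
        exact hl2)
      (by
        rw [show k - (k - 1 - l + 1) = l by ring, show d - (k - 1 - l + 1) = l + 1 by omega]
        exact hl1)
    rwa [show k - (k - 1 - l + 1) = l by ring, show d - (k - 1 - l + 1 + 1) = l by omega] at this
  obtain ⟨l', e1, e2, e3, e4⟩ :=
    h.exists_triangle hd (l - i).toNat i l hi hlt hlk.le (by omega) hB hA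
  have := hmin l' ⟨e1, by omega, e3, e4⟩
  omega

/-- The case in which the walk attaches to the short arc only: there is a jewel. -/
theorem false_of_strip (h : Shortcut G n k d c p) (hd : d = k + 1)
    (hlong : ∀ i x, 0 < i → i < k → d < x → x < n → ¬ G.Adj (p i) (c x)) : False := by
  have h2 := h.two_mul_lt
  have h3 := h.three_le
  have hB : ∀ i : ℕ, (i : ℤ) < k → G.Adj (p i) (c (i + 1)) := by
    intro i
    induction i with
    | zero => intro _; simpa using h.adj_first_arc
    | succ i ih =>
      intro hik
      push_cast at hik ⊢
      have hBi := ih (by omega)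
      exact h.adj_next hd hlong (by omega) hik hBi
        (h.adj_succ_of_adj hd hlong (by omega) (by omega) hBi)
  have hB2 := hB (k - 2).toNat (by omega)
  have hB1 := hB (k - 1).toNat (by omega)
  rw [show ((k - 2).toNat : ℤ) = k - 2 by omega] at hB2
  rw [show ((k - 1).toNat : ℤ) = k - 1 by omega, show k - 1 + 1 = k by ring] at hB1
  have hA1 := h.adj_succ_of_adj hd hlong (by omega) (by omega) hB2
  rw [show k - 2 + 1 = k - 1 by ring] at hB2 hA1
  obtain ⟨D, hD, hD1, hne, hadjD⟩ := h.exists_long_cycle hd hlong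
  have hN : ((n - 3).toNat : ℤ) = n - 3 := by omega
  have hpath : InducedPathOn G 0 ((n - 3).toNat : ℤ) (fun t => D (k - 2 - t)) :=
    (hD.reflect (k - 2)).path (by omega)
  have hk : D (k - 2 - (n - 3)) = p k := by
    rw [← hD1 k (by omega) le_rfl, ← hD.1]
    congr 1
    ring
  have hp := h.path
  have hadj_end := h.adj (k - 1) (by omega) (by omega)
  have hadj_pre := h.adj (k - 2) (by omega) (by omega)
  rw [show k - 1 + 1 = k by ring] at hadj_end
  rw [show k - 2 + 1 = k - 1 by ring] at hadj_pre
  have hc1 := h.cycle.adj_succ (by omega) (k - 1)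
  rw [show k - 1 + 1 = k by ring] at hc1
  have hnc : ∀ t, 0 < t → t < n - 3 → ∀ y, k - 1 ≤ y → y ≤ k → ¬ G.Adj (c y) (D (k - 2 - t)) := by
    intro t ht ht' y hy hyk hadj
    by_cases hneg : 0 ≤ k - 2 - t
    · have := hadjD y _ (by omega) hyk hneg (by omega) hadj
      omega
    · rw [← hD.1] at hadj
      have := hadjD y _ (by omega) hyk (by omega) (by omega) hadj
      omega
  refine h.no_jewel ⟨p (k - 2), c (k - 1), c k, p k, p (k - 1), (n - 3).toNat,
    fun t => D (k - 2 - (t.val : ℤ)), ?_, hB2, hc1, (h.adj_last_arc hd).symm, hadj_end.symm,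
    hadj_pre.symm, ?_, ?_, ?_, hpath.isInducedPathMap, ?_, ?_, ?_⟩
  · simp only [List.pairwise_cons, List.mem_cons, List.not_mem_nil, or_false, forall_eq_or_imp,
      forall_eq, false_imp_iff, implies_true, List.Pairwise.nil, and_true]
    exact ⟨⟨hB2.ne, h.ne_short_arc (by omega) (by omega) (by omega) (by omega),
      (hp (k - 2) k (by omega) (by omega) le_rfl).1, hadj_pre.ne⟩,
      ⟨hc1.ne, (h.ne_short_arc (by omega) (by omega) (by omega) (by omega)).symm, hA1.ne.symm⟩,
      ⟨(h.adj_last_arc hd).ne.symm, hB1.ne.symm⟩, hadj_end.ne.symm⟩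
  · intro hadj
    have := h.adj_short_arc hd (by omega) (by omega) (by omega) (by omega) hadj
    omega
  · intro hadj
    have := h.adj_short_arc hd (by omega) (by omega) (by omega) (by omega) hadj.symm
    omega
  · rw [(hp (k - 2) k (by omega) (by omega) le_rfl).2]
    omega
  · simpa using hD1 (k - 2) (by omega) (by omega)
  · simpa [hN] using hk
  · intro t ht ht'
    have ht0 : t.val ≠ 0 := fun h0 => ht (Fin.ext h0)
    have htn : t.val ≠ (n - 3).toNat := fun h0 => ht' (Fin.ext h0)
    have htlt := t.isLt
    refine ⟨hnc _ (by omega) (by omega) _ le_rfl (by omega),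
      hnc _ (by omega) (by omega) _ (by omega) le_rfl, ?_⟩
    rw [← hD1 (k - 1) (by omega) (by omega), G.adj_comm,
      (hD.2 (k - 2 - (t.val : ℤ)) (k - 1) (by omega) (by omega)).2]
    omega

theorem false (h : Shortcut G n k d c p) : False := by
  have h2 := h.two_mul_lt
  have h3 := h.three_le
  obtain ⟨α, α', hα⟩ := h.exists_startArc
  obtain ⟨β, β', hβ⟩ := h.reverse.exists_startArc
  rcases h.mid_not_adj_or hα hβ with ⟨hmid, hlt⟩ | ⟨hd, rfl, rfl⟩
  · exact h.false_of_mid_not_adj hα hβ hmid hlt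
  refine h.false_of_strip hd fun i x hi hik hx hxn => ?_
  have ha := hα.le
  have hb := hβ.le
  have hcases : i = 1 ∨ (2 ≤ i ∧ i ≤ k - 2) ∨ i = k - 1 := by omega
  rcases hcases with rfl | hmid | rfl
  · exact hα.not_adj x (by omega) (by omega)
  · exact h.mid_not_adj_long_arc hmid.1 hmid.2 hx hxn
  · have := hβ.not_adj (d + n - x) (by omega) (by omega)
    rwa [show d - (d + n - x) = x - n by ring, h.cycle.sub_period] at this

end Shortcut

section Holes

variable {G : SimpleGraph V}

theorem IsHole.inducedCycle {n : ℕ} {f : ZMod n → V} (h : IsHole G n f) (a : ZMod n) :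
    InducedCycle G n (fun x : ℤ => f (a + x)) := by
  obtain ⟨hn, hinj, hadj⟩ := h
  refine ⟨fun x => by simp, fun x y hxy hy => ⟨fun heq => ?_, ?_⟩⟩
  · have := (ZMod.intCast_eq_intCast_iff_dvd_sub x y n).1 (add_left_cancel (hinj heq))
    have := Int.le_of_dvd (by omega) this
    omega
  · have key : ∀ u v : ℤ, (a + (v : ZMod n) = a + (u : ZMod n) + 1) ↔ (n : ℤ) ∣ u + 1 - v := by
      intro u v
      rw [← ZMod.intCast_eq_intCast_iff_dvd_sub, add_assoc, add_right_inj]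
      push_cast
      rfl
    rw [hadj, key, key]
    constructor
    · rintro (h | h)
      · left
        rw [← Int.dvd_neg] at h
        by_contra hne
        have := Int.le_of_dvd (by omega) h
        omega
      · right
        have := Int.le_of_dvd (by omega) h
        omega
    · rintro (rfl | rfl)
      · simp
      · right
        simp

theorem InducedCycle.isHole {m : ℕ} {D : ℤ → V} (h : InducedCycle G m D) (hm : 4 ≤ m) :
    IsHole G m (fun x : ZMod m => D x.val) := by
  have : NeZero m := ⟨by omega⟩
  have hlt : ∀ x : ZMod m, x.val < m := ZMod.val_lt
  have hsucc : ∀ i j : ZMod m, j = i + 1 ↔ j.val = i.val + 1 ∨ (j.val = 0 ∧ i.val + 1 = m) := by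
    intro i j
    have h1 : (1 : ZMod m).val = 1 := ZMod.val_one'' (by omega)
    have hi := hlt i
    have hj := hlt j
    rw [← (ZMod.val_injective m).eq_iff, ZMod.val_add, h1]
    rcases eq_or_lt_of_le (show i.val + 1 ≤ m by omega) with heq | hlt'
    · rw [heq, Nat.mod_self]
      omega
    · rw [Nat.mod_eq_of_lt hlt']
      omega
  refine ⟨hm, fun i j hij => ?_, fun i j => ?_⟩
  · by_contra hne
    have hi := hlt i
    have hj := hlt j
    rcases lt_or_gt_of_ne (fun h' => hne (ZMod.val_injective m h')) with hl | hl
    · exact (h.2 i.val j.val (by omega) (by omega)).1 hij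
    · exact (h.2 j.val i.val (by omega) (by omega)).1 hij.symm
  · rw [hsucc, hsucc]
    have hi := hlt i
    have hj := hlt j
    rcases lt_trichotomy i.val j.val with hl | heq | hl
    · rw [(h.2 i.val j.val (by omega) (by omega)).2]
      omega
    · simp only [heq, SimpleGraph.irrefl, false_iff]
      omega
    · rw [G.adj_comm, (h.2 j.val i.val (by omega) (by omega)).2]
      omega

/-- In a graph with no jewel or pyramid, a walk between two vertices of a clean shortest odd hole
is at least as long as one of the two arcs of the hole between them. -/
theorem IsShortestOddHole.arc_le_of_walk (hJ : ¬ ContainsJewel G) (hP : ¬ ContainsPyramid G)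
    {n : ℕ} {f : ZMod n → V} (hC : IsShortestOddHole G n f) (hclean : ∀ v : V, ¬ IsCMajor G f v)
    {x y : ℤ} {m : ℤ} (hxy : x ≤ y) (hy : y ≤ x + n) (hw : WalkWithin G m (f x) (f y)) :
    y - x ≤ m ∨ x + n - y ≤ m := by
  classical
  obtain ⟨⟨hhole, hodd⟩, hshort⟩ := hC
  have hn := hhole.1
  let Bad : ℕ → Prop := fun k => ∃ x y : ℤ, x ≤ y ∧ y ≤ x + n ∧
    WalkWithin G k (f x) (f y) ∧ (k : ℤ) < y - x ∧ (k : ℤ) < x + n - y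
  suffices hno : ¬ ∃ k, Bad k by
    by_contra hcon
    obtain ⟨w, hwm⟩ := hw
    exact hno ⟨w.length, x, y, hxy, hy, ⟨w, le_rfl⟩, by omega, by omega⟩
  intro hex
  obtain ⟨k, hbad, hmin⟩ : ∃ k, Bad k ∧ ∀ l, l < k → ¬ Bad l :=
    ⟨Nat.find hex, Nat.find_spec hex, fun l => Nat.find_min hex⟩
  have hodd' : Odd (n : ℤ) := by exact_mod_cast hodd
  obtain ⟨x, d, hd0, hdn, hw, hkd⟩ : ∃ x d : ℤ, 0 ≤ d ∧ 2 * d < n ∧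
      WalkWithin G k (f x) (f ((x + d : ℤ) : ZMod n)) ∧ k < d := by
    obtain ⟨x, y, hxy, hy, hw, h1, h2⟩ := hbad
    by_cases hlt : 2 * (y - x) < n
    · exact ⟨x, y - x, by omega, hlt, by simpa using hw, h1⟩
    · obtain ⟨e, he⟩ := hodd'
      refine ⟨y, x + n - y, by omega, by omega, ?_, h2⟩
      have := hw.symm
      rwa [show y + (x + n - y) = x + n by ring, Int.cast_add, Int.cast_natCast,
        ZMod.natCast_self, add_zero]
  obtain ⟨w, hwk⟩ := hw
  have hlen : w.length = k := by
    by_contra hne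
    exact hmin w.length (by omega) ⟨x, x + d, by omega, by omega, ⟨w, le_rfl⟩, by omega, by omega⟩
  refine Shortcut.false (G := G) (n := n) (k := k) (d := d)
    (c := fun t : ℤ => f ((x : ZMod n) + t)) (p := fun i => w.getVert i.toNat) ?_
  refine ⟨hhole.inducedCycle _, hodd', ?_, ?_, hP, hJ, by omega, hkd, hdn, by simp, ?_, ?_, ?_⟩
  · intro m D hD hm hmn
    lift m to ℕ using by omega
    by_contra hne
    have hmo : Odd m := by exact_mod_cast Int.not_even_iff_odd.1 hne
    have := hshort m _ ⟨hD.isHole (by omega), hmo⟩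
    omega
  · intro v hv
    have hvr : v ∉ Set.range f := by
      rintro ⟨i, rfl⟩
      apply hv (i - x : ZMod n).cast
      simp
    have hnm := hclean v
    simp only [IsCMajor, hvr, not_false_eq_true, true_and, not_forall, not_exists, not_and,
      ne_eq, not_not] at hnm
    obtain ⟨i, hi⟩ := hnm
    obtain ⟨s, hs⟩ := ZMod.intCast_surjective (i - (x : ZMod n))
    obtain rfl : i = (x : ZMod n) + s := by rw [hs]; ring
    have hne : ∀ r t : ℤ, 0 < t - r → t - r < n → (x : ZMod n) + t ≠ x + r := by
      intro r t h0 hlt heq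
      have hdvd := (ZMod.intCast_eq_intCast_iff_dvd_sub r t n).1 (add_left_cancel heq).symm
      have := Int.le_of_dvd h0 hdvd
      omega
    refine ⟨s, fun t ht ht' hadj => ?_⟩
    refine hne (s + 1) t (by omega) (by omega) ?_
    have := hi _ hadj (fun h => hne (s - 1) t (by omega) (by omega) ?_)
      (hne s t (by omega) (by omega))
    · simpa [add_assoc] using this
    · simpa [add_sub_assoc] using h
  · simp [← hlen]
  · intro i hi hik
    have := w.adj_getVert_succ (i := i.toNat) (by omega)
    rwa [show (i + 1).toNat = i.toNat + 1 by omega]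
  · intro m u v hm huv hv hw
    by_contra hcon
    obtain ⟨w', hw'⟩ := hw
    refine hmin w'.length (by omega) ⟨x + u, x + v, by omega, by omega, ?_, by omega, by omega⟩
    push_cast
    exact ⟨w', le_rfl⟩

end Holes

/-- Let `G` contain no jewel or pyramid, and let `C` be a clean shortest
odd hole in `G`. Let `u = f a` and `v = f b` be distinct nonadjacent vertices of `C`,
and let `L1` be the shorter of the two subpaths of `C` joining them (here `L1` is the
arc from `a` to `b = a + k` of length `k`, with `2 ≤ k` and `2 * k < n`, so that the
other subpath `L2` is strictly longer). Then `L1` is a shortest path in `G` between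
`u` and `v`, i.e. the distance in `G` from `f a` to `f b` equals `k`. -/
theorem short_arc_is_shortest_path {V : Type*} [Fintype V] (G : SimpleGraph V)
    (hJ : ¬ ContainsJewel G) (hP : ¬ ContainsPyramid G)
    (n : ℕ) (f : ZMod n → V) (hC : IsShortestOddHole G n f)
    (hclean : ∀ v : V, ¬ IsCMajor G f v)
    (a b : ZMod n) (k : ℕ) (hk2 : 2 ≤ k) (hklt : 2 * k < n)
    (hb : b = a + (k : ZMod n)) :
    G.dist (f a) (f b) = k := by
  subst hb
  obtain ⟨s, rfl⟩ := ZMod.intCast_surjective a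
  have hstep : ∀ i : ℤ, 0 ≤ i → i < k →
      G.Adj (f (s + (i : ZMod n))) (f (s + ((i + 1 : ℤ) : ZMod n))) :=
    fun i _ _ => (hC.1.1.2.2 _ _).2 (.inl (by push_cast; ring))
  obtain ⟨w, hw⟩ : WalkWithin G k (f s) (f (s + (k : ZMod n))) := by
    simpa using WalkWithin.along hstep le_rfl (Int.natCast_nonneg k) le_rfl
  have hle := SimpleGraph.dist_le w
  obtain ⟨p, hp⟩ := w.reachable.exists_walk_length_eq_dist
  have harc := hC.arc_le_of_walk hJ hP hclean (x := s) (y := s + k)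
    (m := G.dist (f s) (f (s + (k : ZMod n)))) (by omega) (by omega)
    (by push_cast; exact ⟨p, by rw [hp]⟩)
  omega
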